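/- For every d ≥ 1 and p ≥ 0 there exists a constant C (depending only on d and p) such that the following holds: for every γ ∈ (0,1], every Δ ≥ 0, and every matrix M : ℤ^d × ℤ^d → ℂ with |M_a^b| ≤ e^{−γ|a−b|} for all a, b and M_a^b = 0 whenever |a−b| ≤ Δ, and for every z : ℤ^d → ℂ with ‖z‖_p < ∞, one has ‖Mz‖_p ≤ C·γ^{−(d+p)}·e^{−γΔ/2}·‖z‖_p, where (Mz)_a = ∑_{b∈ℤ^d} M_a^b z_b. -/

import Mathlib

/-- The Euclidean norm of a lattice point `a ∈ ℤ^d`. -/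
noncomputable def latNorm {d : ℕ} (a : Fin d → ℤ) : ℝ :=
  Real.sqrt (∑ i, ((a i : ℝ)) ^ 2)

/-- The weight `⟨a⟩^{2p}` with `⟨a⟩ = max(|a|,1)` of the weighted `ℓ²` norm
`‖z‖_p = (∑_a ⟨a⟩^{2p}|z_a|²)^{1/2}`. -/
noncomputable def latWeight {d : ℕ} (p : ℝ) (a : Fin d → ℤ) : ℝ :=
  (max (latNorm a) 1) ^ (2 * p)

/-- Cauchy–Schwarz for infinite sums of nonnegative reals, in the form `r² = f g`. -/
theorem summable_and_sq_tsum_le_of_sq_eq_mul {ι : Type*} {r f g : ι → ℝ}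
    (hr : ∀ i, 0 ≤ r i) (hf : ∀ i, 0 ≤ f i) (hg : ∀ i, 0 ≤ g i)
    (h : ∀ i, r i ^ 2 = f i * g i) (hfs : Summable f) (hgs : Summable g) :
    Summable r ∧ (∑' i, r i) ^ 2 ≤ (∑' i, f i) * ∑' i, g i := by
  have hF : 0 ≤ ∑' i, f i := tsum_nonneg hf
  have hG : 0 ≤ ∑' i, g i := tsum_nonneg hg
  have key : ∀ s : Finset ι, ∑ i ∈ s, r i ≤ √((∑' i, f i) * ∑' i, g i) := by
    intro s
    apply Real.le_sqrt_of_sq_le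
    calc (∑ i ∈ s, r i) ^ 2 ≤ (∑ i ∈ s, f i) * ∑ i ∈ s, g i :=
          Finset.sum_sq_le_sum_mul_sum_of_sq_le_mul s (fun i _ => hf i) (fun i _ => hg i)
            (fun i _ => (h i).le)
      _ ≤ (∑' i, f i) * ∑' i, g i :=
          mul_le_mul (hfs.sum_le_tsum s fun i _ => hf i) (hgs.sum_le_tsum s fun i _ => hg i)
            (Finset.sum_nonneg fun i _ => hg i) hF
  have hs : Summable r := summable_of_sum_le hr key
  refine ⟨hs, ?_⟩
  calc (∑' i, r i) ^ 2 ≤ √((∑' i, f i) * ∑' i, g i) ^ 2 :=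
        pow_le_pow_left₀ (tsum_nonneg hr) (hs.tsum_le_of_sum_le key) 2
    _ = (∑' i, f i) * ∑' i, g i := Real.sq_sqrt (mul_nonneg hF hG)

/-- Young's inequality `‖k * u‖₂ ≤ ‖k‖₁ ‖u‖₂` for nonnegative functions on a discrete group. -/
theorem tsum_sq_convolution_le {G : Type*} [AddCommGroup G] {k u : G → ℝ}
    (hk : ∀ a, 0 ≤ k a) (hu : ∀ a, 0 ≤ u a) (hks : Summable k)
    (hus : Summable fun a => u a ^ 2) :
    (∀ a, Summable fun b => k (a - b) * u b) ∧
      Summable (fun a => (∑' b, k (a - b) * u b) ^ 2) ∧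
      ∑' a, (∑' b, k (a - b) * u b) ^ 2 ≤ (∑' a, k a) ^ 2 * ∑' a, u a ^ 2 := by
  have hprod : Summable fun x : G × G => k x.1 * u x.2 ^ 2 :=
    hks.mul_of_nonneg hus hk fun a => sq_nonneg _
  let e : G × G ≃ G × G :=
    { toFun := fun x => (x.1 - x.2, x.2)
      invFun := fun x => (x.1 + x.2, x.2)
      left_inv := fun x => by simp
      right_inv := fun x => by simp }
  have hshear : Summable fun x : G × G => k (x.1 - x.2) * u x.2 ^ 2 :=
    (e.summable_iff (f := fun x : G × G => k x.1 * u x.2 ^ 2)).2 hprod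
  have htotal : ∑' a, ∑' b, k (a - b) * u b ^ 2 = (∑' a, k a) * ∑' a, u a ^ 2 := by
    rw [hks.tsum_mul_tsum hus hprod, ← e.tsum_eq (fun x : G × G => k x.1 * u x.2 ^ 2)]
    exact (hshear.tsum_prod).symm
  have hcs : ∀ a, (Summable fun b => k (a - b) * u b) ∧
      (∑' b, k (a - b) * u b) ^ 2 ≤ (∑' a, k a) * ∑' b, k (a - b) * u b ^ 2 := by
    intro a
    have h := summable_and_sq_tsum_le_of_sq_eq_mul (r := fun b => k (a - b) * u b)
      (f := fun b => k (a - b)) (g := fun b => k (a - b) * u b ^ 2)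
      (fun b => mul_nonneg (hk _) (hu _)) (fun b => hk _)
      (fun b => mul_nonneg (hk _) (sq_nonneg _)) (fun b => by ring)
      ((Equiv.subLeft a).summable_iff.2 hks) (hshear.prod_factor a)
    have hrefl : ∑' b, k (a - b) = ∑' b, k b := (Equiv.subLeft a).tsum_eq k
    rwa [hrefl] at h
  have hdom : Summable fun a => (∑' a, k a) * ∑' b, k (a - b) * u b ^ 2 :=
    hshear.prod.mul_left _
  have hsum : Summable fun a => (∑' b, k (a - b) * u b) ^ 2 :=
    hdom.of_nonneg_of_le (fun a => sq_nonneg _) fun a => (hcs a).2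
  refine ⟨fun a => (hcs a).1, hsum, ?_⟩
  calc ∑' a, (∑' b, k (a - b) * u b) ^ 2
      ≤ ∑' a, (∑' a, k a) * ∑' b, k (a - b) * u b ^ 2 :=
        hsum.tsum_le_tsum (fun a => (hcs a).2) hdom
    _ = (∑' a, k a) ^ 2 * ∑' a, u a ^ 2 := by rw [tsum_mul_left, htotal]; ring

theorem summable_exp_neg_mul_abs_int_and_tsum_le {s : ℝ} (hs : 0 < s) (hs1 : s ≤ 1) :
    (Summable fun n : ℤ => Real.exp (-(s * |(n : ℝ)|))) ∧
      ∑' n : ℤ, Real.exp (-(s * |(n : ℝ)|)) ≤ 4 / s := by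
  have hr1 : Real.exp (-s) < 1 := Real.exp_lt_one_iff.2 (by linarith)
  have hgeom : HasSum (fun n : ℕ => Real.exp (-s) ^ n) (1 - Real.exp (-s))⁻¹ :=
    hasSum_geometric_of_lt_one (Real.exp_pos _).le hr1
  have hpow : ∀ n : ℕ, Real.exp (-s) ^ n = Real.exp (-(s * n)) := fun n => by
    rw [← Real.exp_nat_mul]; ring_nf
  have hnonneg : HasSum (fun n : ℕ => Real.exp (-(s * |((n : ℤ) : ℝ)|)))
      (1 - Real.exp (-s))⁻¹ := by
    refine hgeom.congr_fun ?_
    intro n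
    simp [hpow]
  have hneg : HasSum (fun n : ℕ => Real.exp (-(s * |((-((n : ℤ) + 1) : ℤ) : ℝ)|)))
      (Real.exp (-s) * (1 - Real.exp (-s))⁻¹) := by
    refine (hgeom.mul_left (Real.exp (-s))).congr_fun ?_
    intro n
    rw [hpow, ← Real.exp_add]
    have : |((-((n : ℤ) + 1) : ℤ) : ℝ)| = n + 1 := by
      push_cast
      rw [abs_neg, abs_of_nonneg (by positivity)]
    rw [this]; ring_nf
  have hall := HasSum.of_nat_of_neg_add_one (f := fun n : ℤ => Real.exp (-(s * |(n : ℝ)|)))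
    hnonneg hneg
  refine ⟨hall.summable, ?_⟩
  rw [hall.tsum_eq]
  have hlow : s / 2 ≤ 1 - Real.exp (-s) := by
    have h1 : 1 + s ≤ Real.exp s := by linarith [Real.add_one_le_exp s]
    have h2 : Real.exp (-s) ≤ (1 + s)⁻¹ := by
      rw [Real.exp_neg]; exact inv_anti₀ (by linarith) h1
    have h3 : (1 + s)⁻¹ ≤ 1 - s / 2 := by
      rw [inv_le_iff_one_le_mul₀ (by linarith)]
      nlinarith
    linarith
  have hinv : (1 - Real.exp (-s))⁻¹ ≤ 2 / s := by
    rw [← inv_div]; exact inv_anti₀ (by positivity) hlow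
  have hinv0 : 0 ≤ (1 - Real.exp (-s))⁻¹ := inv_nonneg.2 (by linarith)
  calc _ ≤ 2 / s + 1 * (2 / s) := add_le_add hinv
          (mul_le_mul hr1.le hinv hinv0 zero_le_one)
    _ = 4 / s := by ring

theorem summable_pi_prod_and_tsum_le {ι κ : Type*} [Fintype ι] {f : κ → ℝ}
    (hf : ∀ n, 0 ≤ f n) (hfs : Summable f) :
    (Summable fun c : ι → κ => ∏ i, f (c i)) ∧
      ∑' c : ι → κ, ∏ i, f (c i) ≤ (∑' n, f n) ^ Fintype.card ι := by
  classical
  have hnn : ∀ c : ι → κ, 0 ≤ ∏ i, f (c i) := fun c => Finset.prod_nonneg fun i _ => hf _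
  have key : ∀ t : Finset (ι → κ), ∑ c ∈ t, ∏ i, f (c i) ≤ (∑' n, f n) ^ Fintype.card ι := by
    intro t
    calc ∑ c ∈ t, ∏ i, f (c i)
        ≤ ∑ c ∈ Fintype.piFinset fun i => t.image fun c => c i, ∏ i, f (c i) := by
          refine Finset.sum_le_sum_of_subset_of_nonneg (fun c hc => ?_) fun c _ _ => hnn c
          exact Fintype.mem_piFinset.2 fun i => Finset.mem_image_of_mem (fun c => c i) hc
      _ = ∏ i, ∑ n ∈ t.image fun c => c i, f n := (Finset.prod_univ_sum _ _).symm
      _ ≤ ∏ _i : ι, ∑' n, f n :=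
          Finset.prod_le_prod (fun i _ => Finset.sum_nonneg fun n _ => hf n)
            fun i _ => hfs.sum_le_tsum _ fun n _ => hf n
      _ = (∑' n, f n) ^ Fintype.card ι := by simp
  have hs := summable_of_sum_le hnn key
  exact ⟨hs, hs.tsum_le_of_sum_le key⟩

theorem latNorm_nonneg {d : ℕ} (a : Fin d → ℤ) : 0 ≤ latNorm a := Real.sqrt_nonneg _

theorem latNorm_le_add_sub {d : ℕ} (a b : Fin d → ℤ) :
    latNorm a ≤ latNorm b + latNorm (a - b) := by
  have hnorm : ∀ c : Fin d → ℤ,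
      latNorm c = ‖(WithLp.toLp 2 fun i => (c i : ℝ) : EuclideanSpace ℝ (Fin d))‖ := fun c => by
    simp [latNorm, EuclideanSpace.norm_eq]
  have hsplit : (WithLp.toLp 2 fun i => (a i : ℝ) : EuclideanSpace ℝ (Fin d)) =
      WithLp.toLp 2 (fun i => (b i : ℝ)) + WithLp.toLp 2 (fun i => ((a - b) i : ℝ)) := by
    ext i; simp
  rw [hnorm a, hnorm b, hnorm (a - b), hsplit]
  exact norm_add_le _ _

theorem sum_abs_le_mul_latNorm {d : ℕ} (a : Fin d → ℤ) :
    ∑ i, |(a i : ℝ)| ≤ d * latNorm a := by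
  calc ∑ i, |(a i : ℝ)| ≤ ∑ _i : Fin d, latNorm a := by
        refine Finset.sum_le_sum fun i _ => Real.abs_le_sqrt ?_
        exact Finset.single_le_sum (f := fun i => (a i : ℝ) ^ 2) (fun j _ => sq_nonneg _)
          (Finset.mem_univ i)
    _ = d * latNorm a := by simp

theorem summable_exp_neg_latNorm_and_tsum_le {d : ℕ} (hd : 1 ≤ d) {γ : ℝ} (hγ : 0 < γ)
    (hγ1 : γ ≤ 1) :
    (Summable fun c : Fin d → ℤ => Real.exp (-(γ / 4 * latNorm c))) ∧
      ∑' c : Fin d → ℤ, Real.exp (-(γ / 4 * latNorm c)) ≤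
        (16 * d : ℝ) ^ d * γ ^ (-(d : ℝ)) := by
  have hd1 : (1 : ℝ) ≤ d := by exact_mod_cast hd
  have hs : 0 < γ / (4 * d) := by positivity
  have hs1 : γ / (4 * d) ≤ 1 := by rw [div_le_one (by positivity)]; linarith
  obtain ⟨hZs, hZ⟩ := summable_exp_neg_mul_abs_int_and_tsum_le hs hs1
  obtain ⟨hPs, hP⟩ := summable_pi_prod_and_tsum_le (ι := Fin d)
    (fun n : ℤ => (Real.exp_pos (-(γ / (4 * d) * |(n : ℝ)|))).le) hZs
  have hle : ∀ c : Fin d → ℤ, Real.exp (-(γ / 4 * latNorm c)) ≤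
      ∏ i, Real.exp (-(γ / (4 * d) * |(c i : ℝ)|)) := by
    intro c
    rw [← Real.exp_sum, Real.exp_le_exp, Finset.sum_neg_distrib, ← Finset.mul_sum, neg_le_neg_iff]
    calc γ / (4 * d) * ∑ i, |(c i : ℝ)| ≤ γ / (4 * d) * (d * latNorm c) :=
          mul_le_mul_of_nonneg_left (sum_abs_le_mul_latNorm c) hs.le
      _ = γ / 4 * latNorm c := by field_simp
  have hsum := hPs.of_nonneg_of_le (fun c => (Real.exp_pos _).le) hle
  refine ⟨hsum, ?_⟩
  calc _ ≤ _ := hsum.tsum_le_tsum hle hPs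
    _ ≤ _ := hP
    _ ≤ (4 / (γ / (4 * d))) ^ d := by
        rw [Fintype.card_fin]
        exact pow_le_pow_left₀ (tsum_nonneg fun n => (Real.exp_pos _).le) hZ d
    _ = (16 * d : ℝ) ^ d * γ ^ (-(d : ℝ)) := by
        rw [Real.rpow_neg hγ.le, Real.rpow_natCast, ← inv_pow, ← mul_pow]
        congr 1
        field_simp
        norm_num

/-- Polynomial growth is absorbed by a small part of the exponential decay. -/
theorem one_add_rpow_le_mul_exp {p γ r : ℝ} (hp : 0 ≤ p) (hγ : 0 < γ) (hγ1 : γ ≤ 1)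
    (hr : 0 ≤ r) :
    (1 + r) ^ p ≤ (4 * p + 1) ^ p * γ ^ (-p) * Real.exp (γ / 4 * r) := by
  have hq : 0 < 4 * p + 1 := by linarith
  have hbase : 1 + r ≤ (4 * p + 1) * γ⁻¹ * Real.exp (γ * r / (4 * p + 1)) := by
    calc 1 + r ≤ γ⁻¹ * (1 + γ * r) := by
          rw [mul_add, inv_mul_cancel_left₀ hγ.ne']
          linarith [(one_le_inv₀ hγ).2 hγ1]
      _ ≤ γ⁻¹ * ((4 * p + 1) * (γ * r / (4 * p + 1) + 1)) := by
          gcongr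
          rw [mul_add, mul_div_cancel₀ _ hq.ne']
          linarith
      _ ≤ γ⁻¹ * ((4 * p + 1) * Real.exp (γ * r / (4 * p + 1))) := by
          gcongr
          exact Real.add_one_le_exp _
      _ = _ := by ring
  calc (1 + r) ^ p ≤ ((4 * p + 1) * γ⁻¹ * Real.exp (γ * r / (4 * p + 1))) ^ p :=
        Real.rpow_le_rpow (by linarith) hbase hp
    _ = (4 * p + 1) ^ p * γ ^ (-p) * Real.exp (γ * r / (4 * p + 1) * p) := by
        rw [Real.mul_rpow (by positivity) (Real.exp_pos _).le,
          Real.mul_rpow hq.le (by positivity), Real.inv_rpow hγ.le, ← Real.rpow_neg hγ.le,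
          ← Real.exp_mul]
    _ ≤ _ := by
        refine mul_le_mul_of_nonneg_left (Real.exp_le_exp.2 ?_) (by positivity)
        rw [div_mul_eq_mul_div, div_le_iff₀ hq]
        nlinarith [mul_nonneg hγ.le hr]

theorem max_latNorm_rpow_le_mul {d : ℕ} {p : ℝ} (hp : 0 ≤ p) (a b : Fin d → ℤ) :
    (max (latNorm a) 1) ^ p ≤ (1 + latNorm (a - b)) ^ p * (max (latNorm b) 1) ^ p := by
  have hab := latNorm_nonneg (a - b)
  have hm1 : 1 ≤ max (latNorm b) 1 := le_max_right _ _
  have hmb : latNorm b ≤ max (latNorm b) 1 := le_max_left _ _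
  rw [← Real.mul_rpow (by linarith) (by linarith)]
  refine Real.rpow_le_rpow (le_max_of_le_right zero_le_one) (max_le ?_ ?_) hp
  · nlinarith [latNorm_le_add_sub a b]
  · nlinarith

theorem latWeight_eq_sq {d : ℕ} (p : ℝ) (a : Fin d → ℤ) :
    latWeight p a = ((max (latNorm a) 1) ^ p) ^ 2 := by
  rw [latWeight, mul_comm, Real.rpow_mul (le_max_of_le_right zero_le_one), Real.rpow_two]

/-- **Operator bound for the far-off-diagonal truncation**: a matrix with exponentially
decaying entries `|M_a^b| ≤ e^{−γ|a−b|}` vanishing for `|a−b| ≤ Δ` acts on the weighted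
`ℓ²` space with norm at most `C·γ^{−(d+p)}·e^{−γΔ/2}`. -/
theorem far_offdiagonal_truncation_bound
    (d : ℕ) (hd : 1 ≤ d) (p : ℝ) (hp : 0 ≤ p) :
    ∃ C : ℝ, 0 < C ∧ ∀ γ : ℝ, 0 < γ → γ ≤ 1 → ∀ Δ : ℝ, 0 ≤ Δ →
      ∀ M : (Fin d → ℤ) → (Fin d → ℤ) → ℂ,
        (∀ a b, ‖M a b‖ ≤ Real.exp (-(γ * latNorm (a - b)))) →
        (∀ a b, latNorm (a - b) ≤ Δ → M a b = 0) →
        ∀ z : (Fin d → ℤ) → ℂ, Summable (fun a => latWeight p a * ‖z a‖ ^ 2) →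
          (∀ a, Summable (fun b => M a b * z b)) ∧
          Summable (fun a => latWeight p a * ‖∑' b, M a b * z b‖ ^ 2) ∧
          Real.sqrt (∑' a, latWeight p a * ‖∑' b, M a b * z b‖ ^ 2) ≤
            C * γ ^ (-((d : ℝ) + p)) * Real.exp (-(γ * Δ) / 2) *
              Real.sqrt (∑' a, latWeight p a * ‖z a‖ ^ 2) := by
  have hq : 0 < 4 * p + 1 := by linarith
  have hd0 : (0 : ℝ) < d := by exact_mod_cast hd
  refine ⟨(4 * p + 1) ^ p * (16 * d : ℝ) ^ d, by positivity, ?_⟩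
  intro γ hγ hγ1 Δ _ M hM hM0 z hz
  set w : (Fin d → ℤ) → ℝ := fun a => (max (latNorm a) 1) ^ p
  have hw1 : ∀ a, 1 ≤ w a := fun a => Real.one_le_rpow (le_max_right _ _) hp
  have hw0 : ∀ a, 0 < w a := fun a => one_pos.trans_le (hw1 a)
  have hwsq : ∀ a (t : ℝ), latWeight p a * t ^ 2 = (w a * t) ^ 2 := fun a t => by
    rw [latWeight_eq_sq, mul_pow]
  simp only [hwsq] at hz ⊢
  set A : ℝ := (4 * p + 1) ^ p * γ ^ (-p) * Real.exp (-(γ * Δ) / 2) with hA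
  have hA0 : 0 < A := by positivity
  set k : (Fin d → ℤ) → ℝ := fun c => Real.exp (-(γ / 4 * latNorm c)) with hk
  have hk0 : ∀ c, 0 ≤ k c := fun c => (Real.exp_pos _).le
  obtain ⟨hks, hkle⟩ := summable_exp_neg_latNorm_and_tsum_le hd hγ hγ1
  obtain ⟨hconv, hconvsq, hyoung⟩ := tsum_sq_convolution_le (k := k)
    (u := fun b => w b * ‖z b‖) hk0 (fun b => mul_nonneg (hw0 b).le (norm_nonneg _)) hks hz
  have hentry : ∀ a b, w a * ‖M a b‖ ≤ A * k (a - b) * w b := by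
    intro a b
    have hr := latNorm_nonneg (a - b)
    rcases le_or_gt (latNorm (a - b)) Δ with h | h
    · rw [hM0 a b h, norm_zero, mul_zero]
      exact mul_nonneg (mul_nonneg hA0.le (hk0 _)) (hw0 b).le
    · have hexp : Real.exp (-(γ * latNorm (a - b))) ≤
          Real.exp (-(γ * Δ) / 2) * Real.exp (-(γ / 2 * latNorm (a - b))) := by
        rw [← Real.exp_add, Real.exp_le_exp]
        nlinarith [mul_le_mul_of_nonneg_left h.le hγ.le]
      calc w a * ‖M a b‖
          ≤ ((4 * p + 1) ^ p * γ ^ (-p) * Real.exp (γ / 4 * latNorm (a - b)) * w b) *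
            (Real.exp (-(γ * Δ) / 2) * Real.exp (-(γ / 2 * latNorm (a - b)))) := by
            refine mul_le_mul ((max_latNorm_rpow_le_mul hp a b).trans ?_) ((hM a b).trans hexp)
              (norm_nonneg _) (by have := hw0 b; positivity)
            exact mul_le_mul_of_nonneg_right (one_add_rpow_le_mul_exp hp hγ hγ1 hr) (hw0 b).le
        _ = A * (Real.exp (γ / 4 * latNorm (a - b)) *
              Real.exp (-(γ / 2 * latNorm (a - b)))) * w b := by rw [hA]; ring
        _ = A * k (a - b) * w b := by
            rw [← Real.exp_add, hk]
            ring_nf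
  have hterm : ∀ a b, w a * ‖M a b * z b‖ ≤ A * (k (a - b) * (w b * ‖z b‖)) := by
    intro a b
    rw [norm_mul, ← mul_assoc]
    exact (mul_le_mul_of_nonneg_right (hentry a b) (norm_nonneg _)).trans_eq (by ring)
  have hnorm : ∀ a, Summable fun b => ‖M a b * z b‖ := fun a =>
    ((hconv a).mul_left A).of_nonneg_of_le (fun b => norm_nonneg _) fun b =>
      (le_mul_of_one_le_left (norm_nonneg _) (hw1 a)).trans (hterm a b)
  have hrow : ∀ a, (w a * ‖∑' b, M a b * z b‖) ^ 2 ≤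
      A ^ 2 * (∑' b, k (a - b) * (w b * ‖z b‖)) ^ 2 := by
    intro a
    rw [← mul_pow]
    refine pow_le_pow_left₀ (mul_nonneg (hw0 a).le (norm_nonneg _)) ?_ 2
    calc w a * ‖∑' b, M a b * z b‖ ≤ w a * ∑' b, ‖M a b * z b‖ :=
          mul_le_mul_of_nonneg_left (norm_tsum_le_tsum_norm (hnorm a)) (hw0 a).le
      _ = ∑' b, w a * ‖M a b * z b‖ := tsum_mul_left.symm
      _ ≤ ∑' b, A * (k (a - b) * (w b * ‖z b‖)) :=
          ((hnorm a).mul_left _).tsum_le_tsum (hterm a) ((hconv a).mul_left A)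
      _ = A * ∑' b, k (a - b) * (w b * ‖z b‖) := tsum_mul_left
  have hsum := (hconvsq.mul_left (A ^ 2)).of_nonneg_of_le (fun a => sq_nonneg _) hrow
  refine ⟨fun a => (hnorm a).of_norm, hsum, ?_⟩
  have hK0 : 0 ≤ ∑' c, k c := tsum_nonneg hk0
  calc √(∑' a, (w a * ‖∑' b, M a b * z b‖) ^ 2)
      ≤ √((A * ∑' c, k c) ^ 2 * ∑' a, (w a * ‖z a‖) ^ 2) := by
        refine Real.sqrt_le_sqrt ((hsum.tsum_le_tsum hrow (hconvsq.mul_left _)).trans ?_)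
        rw [tsum_mul_left, mul_pow A, mul_assoc (A ^ 2)]
        exact mul_le_mul_of_nonneg_left hyoung (sq_nonneg A)
    _ = A * (∑' c, k c) * √(∑' a, (w a * ‖z a‖) ^ 2) := by
        rw [Real.sqrt_mul (sq_nonneg _), Real.sqrt_sq (mul_nonneg hA0.le hK0)]
    _ ≤ A * ((16 * d : ℝ) ^ d * γ ^ (-(d : ℝ))) * √(∑' a, (w a * ‖z a‖) ^ 2) := by
        gcongr
    _ = _ := by
        rw [hA, neg_add, Real.rpow_add hγ]
        ring
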